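/- arXiv:2102.04793 — 2 statements merged into one kernel-verified Lean document; each statement's English description precedes it below -/
import Mathlib

section
/- Let T̄ be an upper transition operator on ℒ(X) such that 𝒢(T̄) has a top class ℛ that is not absorbing. Then there is a nonempty subset A ⊆ X∖ℛ such that 𝟙_A ≤ T̄𝟙_A pointwise. -/
open Filter Topology

namespace WeakErg

variable {X : Type*} [Fintype X] [Nonempty X]

/-- Indicator function of a set, as a real-valued function. -/
noncomputable def ind (A : Set X) : X → ℝ := A.indicator 1

/-- Upper transition operator axioms: dominated by the max, sub-additive,
non-negatively homogeneous. -/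
def IsUTO (T : (X → ℝ) → (X → ℝ)) : Prop :=
  (∀ (h : X → ℝ) (x : X), T h x ≤ ⨆ y, h y) ∧
  (∀ (h g : X → ℝ) (x : X), T (h + g) x ≤ T h x + T g x) ∧
  (∀ (l : ℝ), 0 ≤ l → ∀ h : X → ℝ, T (l • h) = l • T h)

/-- The topical map `T̄_f : h ↦ f + T̄ h`. -/
def Tf (T : (X → ℝ) → (X → ℝ)) (f : X → ℝ) : (X → ℝ) → (X → ℝ) :=
  fun h => f + T h

/-- Edge relation of the (upper) accessibility graph 𝒢(T): an edge from `x` to `y`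
iff `[T 𝟙_y](x) > 0`. -/
def Edge (T : (X → ℝ) → (X → ℝ)) (x y : X) : Prop := 0 < T (ind {y}) x

/-- Accessibility: `x = y` or there is a directed path from `x` to `y`. -/
def Acc' (T : (X → ℝ) → (X → ℝ)) : X → X → Prop := Relation.ReflTransGen (Edge T)

/-- `x` and `y` communicate. -/
def Comm (T : (X → ℝ) → (X → ℝ)) (x y : X) : Prop := Acc' T x y ∧ Acc' T y x

/-- `S` is a communication class: an equivalence class of the communication relation. -/
def IsCommClass (T : (X → ℝ) → (X → ℝ)) (S : Set X) : Prop :=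
  ∃ x : X, S = {y | Comm T x y}

/-- A nonempty set `S` is closed in 𝒢(T): no state outside `S` is accessible from `S`. -/
def ClosedIn (T : (X → ℝ) → (X → ℝ)) (S : Set X) : Prop :=
  S.Nonempty ∧ ∀ x ∈ S, ∀ y ∉ S, ¬ Acc' T x y

/-- 𝒢(T) is strongly connected. -/
def StronglyConnected (T : (X → ℝ) → (X → ℝ)) : Prop := ∀ x y : X, Acc' T x y

/-- A set `S` is absorbing for `T`: from each state outside `S` the `k`-step upper
probability of staying outside `S` drops below 1 for some `k`. -/
def Absorbing (T : (X → ℝ) → (X → ℝ)) (S : Set X) : Prop :=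
  ∀ x ∉ S, ∃ k : ℕ, T^[k] (ind Sᶜ) x < 1

/-- `R` is a top class of 𝒢(T): a communication class accessible from every state. -/
def IsTopClass (T : (X → ℝ) → (X → ℝ)) (R : Set X) : Prop :=
  IsCommClass T R ∧ ∀ x : X, ∀ y ∈ R, Acc' T x y

/-- (TCA): 𝒢(T) has a top class that is absorbing. -/
def TCA (T : (X → ℝ) → (X → ℝ)) : Prop :=
  ∃ R : Set X, IsTopClass T R ∧ Absorbing T R

/-- `T` is weakly ergodic: for every `f`, the upper expected time averages
`(1/k)·[T̄_f^k(0)](x)` converge to a limit independent of `x`. -/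
def WeaklyErgodic (T : (X → ℝ) → (X → ℝ)) : Prop :=
  ∀ f : X → ℝ, ∃ μ : ℝ, ∀ x : X,
    Tendsto (fun k : ℕ => (1 / (k : ℝ)) * (Tf T f)^[k] 0 x) atTop (𝓝 μ)

/-- `μ` is an additive eigenvalue of `G`. -/
def IsAddEigenvalue (G : (X → ℝ) → (X → ℝ)) (μ : ℝ) : Prop :=
  ∃ h : X → ℝ, G h = h + fun _ => μ

/-- A transition matrix on `X`: nonnegative entries with rows summing to one. -/
structure TransMat (Y : Type*) [Fintype Y] where
  P : Y → Y → ℝ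
  nonneg : ∀ x y, 0 ≤ P x y
  rowSum : ∀ x, ∑ y, P x y = 1

/-- The action of a transition matrix on functions. -/
def TransMat.apply (T : TransMat X) (h : X → ℝ) : X → ℝ :=
  fun x => ∑ y, T.P x y * h y

/-- A set of transition matrices is separately specified. -/
def SepSpec (𝒯 : Set (TransMat X)) : Prop :=
  ∀ T₁ ∈ 𝒯, ∀ T₂ ∈ 𝒯, ∀ A : Set X, ∃ T₃ ∈ 𝒯,
    (∀ x ∈ A, T₃.P x = T₁.P x) ∧ (∀ y ∉ A, T₃.P y = T₂.P y)

/-- `Tbar` is the upper envelope of the set `𝒯` of transition matrices. -/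
def IsUpperEnv (𝒯 : Set (TransMat X)) (Tbar : (X → ℝ) → (X → ℝ)) : Prop :=
  ∀ (h : X → ℝ) (x : X), Tbar h x = ⨆ T : 𝒯, TransMat.apply T.1 h x

/-- The repetition-independent upper expected time average
`sup_{T ∈ 𝒯} (1/k)·[T_f^k(0)](x)`. -/
noncomputable def riSeq (𝒯 : Set (TransMat X)) (f : X → ℝ) (x : X) (k : ℕ) : ℝ :=
  ⨆ T : 𝒯, (1 / (k : ℝ)) * (Tf (TransMat.apply T.1) f)^[k] 0 x

/-- Weak ergodicity of the imprecise Markov chain under repetition independence. -/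
def RIWeaklyErgodic (𝒯 : Set (TransMat X)) : Prop :=
  ∀ f : X → ℝ, ∃ μ : ℝ, ∀ x : X, Tendsto (riSeq 𝒯 f x) atTop (𝓝 μ)

end WeakErg

namespace WeakErg

theorem IsUTO.le_const {X : Type*} [Fintype X] [Nonempty X] {T : (X → ℝ) → (X → ℝ)}
    (hT : IsUTO T) (h : X → ℝ) (c : ℝ) (hc : ∀ y, h y ≤ c) (x : X) : T h x ≤ c :=
  (hT.1 h x).trans (ciSup_le hc)

theorem IsUTO.mono {X : Type*} [Fintype X] [Nonempty X] {T : (X → ℝ) → (X → ℝ)}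
    (hT : IsUTO T) (h g : X → ℝ) (hg : ∀ y, h y ≤ g y) (x : X) : T h x ≤ T g x := by
  have h1 := hT.2.1 g (h - g) x
  have h2 := hT.le_const (h - g) 0 (fun y => by simpa using hg y) x
  rw [add_sub_cancel] at h1
  linarith

theorem IsUTO.zero {X : Type*} [Fintype X] [Nonempty X] {T : (X → ℝ) → (X → ℝ)}
    (hT : IsUTO T) : T 0 = 0 := by
  have := hT.2.2 0 le_rfl 0
  simpa using this

theorem ind_mem {X : Type*} {A : Set X} {x : X} (h : x ∈ A) : ind A x = 1 := by
  simp [ind, h]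

theorem ind_notMem {X : Type*} {A : Set X} {x : X} (h : x ∉ A) : ind A x = 0 := by
  simp [ind, h]

theorem ind_nonneg {X : Type*} (A : Set X) (x : X) : 0 ≤ ind A x := by
  by_cases h : x ∈ A
  · simp [ind_mem h]
  · simp [ind_notMem h]

theorem ind_le_one {X : Type*} (A : Set X) (x : X) : ind A x ≤ 1 := by
  by_cases h : x ∈ A
  · simp [ind_mem h]
  · simp [ind_notMem h]

theorem IsUTO.ind_nonpos {X : Type*} [Fintype X] [Nonempty X] {T : (X → ℝ) → (X → ℝ)}
    (hT : IsUTO T) (x : X) (s : Finset X) (hs : ∀ y ∈ s, T (ind {y}) x ≤ 0) :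
    T (ind (s : Set X)) x ≤ 0 := by
  classical
  induction s using Finset.induction_on with
  | empty =>
    have : ind ((∅ : Finset X) : Set X) = 0 := by ext; simp [ind]
    rw [this, hT.zero]; simp
  | insert a s ha ih =>
    have h1 : ind ((insert a s : Finset X) : Set X) = ind {a} + ind (s : Set X) := by
      ext y
      by_cases hy : y = a
      · subst hy; simp [ind, ha]
      · simp [ind, hy, Set.indicator]
    rw [h1]
    have h2 := hT.2.1 (ind {a}) (ind (s : Set X)) x
    have h3 := hs a (by simp)
    have h4 := ih (fun y hy => hs y (by simp [hy]))
    linarith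

/-- if 𝒢(T̄) has a top class `ℛ` that is not absorbing, then there is
a nonempty `A ⊆ ℛᶜ` with `𝟙_A ≤ T̄𝟙_A` pointwise. -/
theorem exists_subInvariant_indicator {X : Type*} [Fintype X] [Nonempty X]
    (T : (X → ℝ) → (X → ℝ)) (hT : IsUTO T) (R : Set X)
    (htop : IsTopClass T R) (hnabs : ¬ Absorbing T R) :
    ∃ A : Set X, A.Nonempty ∧ A ⊆ Rᶜ ∧ ∀ x : X, ind A x ≤ T (ind A) x := by
  classical
  obtain ⟨⟨x0, hR⟩, hacc⟩ := htop
  have hx0 : x0 ∈ R := by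
    rw [hR]; exact ⟨Relation.ReflTransGen.refl, Relation.ReflTransGen.refl⟩
  have hclosed : ∀ z ∈ R, T (ind Rᶜ) z ≤ 0 := by
    intro z hz
    have := hT.ind_nonpos z (Rᶜ).toFinset (fun y hy => by
      by_contra hlt
      have hyR : y ∉ R := by simpa using hy
      apply hyR
      have hz' := hz
      rw [hR] at hz' ⊢
      exact ⟨Relation.ReflTransGen.tail hz'.1 (not_le.mp hlt), hacc y x0 hx0⟩)
    rwa [Set.coe_toFinset] at this
  have h10 : ∀ x, T (ind Rᶜ) x ≤ ind Rᶜ x := by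
    intro x
    by_cases hx : x ∈ R
    · exact (hclosed x hx).trans (ind_nonneg _ _)
    · rw [ind_mem (show x ∈ Rᶜ from hx)]
      exact hT.le_const _ _ (ind_le_one _) x
  have hstep : ∀ k x, T^[k+1] (ind Rᶜ) x ≤ T^[k] (ind Rᶜ) x := by
    intro k
    induction k with
    | zero => simpa using h10
    | succ k ih =>
      intro x
      rw [Function.iterate_succ_apply' T (k+1), Function.iterate_succ_apply' T k]
      have := hT.mono _ _ ih x
      rwa [Function.iterate_succ_apply' T k] at this
  have hanti : ∀ x, Antitone (fun k => T^[k] (ind Rᶜ) x) :=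
    fun x => antitone_nat_of_succ_le (fun k => hstep k x)
  unfold Absorbing at hnabs
  push Not at hnabs
  obtain ⟨x1, -, hx1⟩ := hnabs
  set A : Set X := {x | ∀ k : ℕ, 1 ≤ T^[k] (ind Rᶜ) x} with hA
  have hex : ∀ y, ∃ k : ℕ, y ∉ A → T^[k] (ind Rᶜ) y < 1 := by
    intro y
    by_cases hy : y ∈ A
    · exact ⟨0, fun h => absurd hy h⟩
    · have hy' := hy
      simp only [hA, Set.mem_ofPred_eq, not_forall, not_le] at hy'
      obtain ⟨k, hk⟩ := hy'
      exact ⟨k, fun _ => hk⟩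
  choose k hk using hex
  set N := Finset.univ.sup k with hN
  have hlt : ∀ y, y ∉ A → T^[N] (ind Rᶜ) y < 1 := fun y hy =>
    (hanti y (Finset.le_sup (Finset.mem_univ y))).trans_lt (hk y hy)
  obtain ⟨c, hc1, hc⟩ : ∃ c : ℝ, c < 1 ∧ ∀ y, y ∉ A → T^[N] (ind Rᶜ) y ≤ c := by
    obtain ⟨y0, hy0⟩ := Finite.exists_max
      (fun y => if y ∈ A then (0 : ℝ) else T^[N] (ind Rᶜ) y)
    refine ⟨if y0 ∈ A then (0 : ℝ) else T^[N] (ind Rᶜ) y0, ?_, fun y hy => ?_⟩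
    · split_ifs with h
      · exact one_pos
      · exact hlt _ h
    · have := hy0 y
      rwa [if_neg hy] at this
  refine ⟨A, ⟨x1, hx1⟩, ?_, ?_⟩
  · intro x hx hxR
    have := hx 0
    rw [Function.iterate_zero, id, ind_notMem (by simpa using hxR)] at this
    linarith
  · intro x
    by_cases hx : x ∈ A
    · rw [ind_mem hx]
      have h1 := hx (N+1)
      rw [Function.iterate_succ_apply'] at h1
      have h2 := hT.mono (T^[N] (ind Rᶜ)) ((fun _ => c) + (1 - c) • ind A) (fun y => by
        by_cases hy : y ∈ A
        · simp only [Pi.add_apply, Pi.smul_apply, ind_mem hy, smul_eq_mul]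
          have := hanti y (Nat.zero_le N)
          have h3 := ind_le_one Rᶜ y
          simp only [Function.iterate_zero, id] at this
          linarith
        · simp only [Pi.add_apply, Pi.smul_apply, ind_notMem hy, smul_eq_mul]
          have := hc y hy
          linarith) x
      have h3 := hT.2.1 (fun _ => c) ((1 - c) • ind A) x
      have h4 := hT.le_const (fun _ => c) c (fun _ => le_rfl) x
      rw [hT.2.2 (1 - c) (by linarith)] at h3
      simp only [Pi.smul_apply, smul_eq_mul] at h3
      have h5 : (1 - c) * 1 ≤ (1 - c) * T (ind A) x := by linarith
      exact le_of_mul_le_mul_left h5 (by linarith)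
    · rw [ind_notMem hx]
      have := hT.mono 0 (ind A) (ind_nonneg A) x
      rwa [hT.zero] at this

end WeakErg
end

section
/- Let T̄ be an upper transition operator on ℒ(X) and let S ⊆ X be a closed class of 𝒢(T̄) that is absorbing. Then lim_{k→∞} [T̄^k 𝟙_{X∖S}](x) = 0 for every x ∈ X. -/
open Filter Topology

namespace WeakErg

theorem uto_mono {X : Type*} [Fintype X] [Nonempty X]
    (T : (X → ℝ) → (X → ℝ)) (hT : IsUTO T) : Monotone T := by
  intro h g hg x
  have h1 := hT.2.1 g (h - g) x
  rw [add_sub_cancel] at h1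
  have h2 := hT.1 (h - g) x
  have h3 : (⨆ y, (h - g) y) ≤ 0 := ciSup_le fun y => by
    have := hg y
    simp only [Pi.sub_apply]
    linarith
  linarith

theorem uto_zero {X : Type*} [Fintype X] [Nonempty X]
    (T : (X → ℝ) → (X → ℝ)) (hT : IsUTO T) : T 0 = 0 := by
  have := hT.2.2 0 le_rfl 0
  simpa using this

theorem uto_sum {X : Type*} [Fintype X] [Nonempty X]
    (T : (X → ℝ) → (X → ℝ)) (hT : IsUTO T) (s : Finset X) (F : X → X → ℝ) (x : X) :
    T (∑ y ∈ s, F y) x ≤ ∑ y ∈ s, T (F y) x := by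
  classical
  induction s using Finset.induction_on with
  | empty => simp [uto_zero T hT]
  | insert a s ha ih =>
    rw [Finset.sum_insert ha, Finset.sum_insert ha]
    have := hT.2.1 (F a) (∑ y ∈ s, F y) x
    linarith

theorem uto_ind_le {X : Type*} [Fintype X] [Nonempty X]
    (T : (X → ℝ) → (X → ℝ)) (hT : IsUTO T) (S : Set X)
    (hcl : ClosedIn T S) : T (ind Sᶜ) ≤ ind Sᶜ := by
  classical
  intro x
  by_cases hx : x ∈ S
  · have e : ind Sᶜ = ∑ y ∈ Finset.univ.filter (fun y => y ∉ S), ind ({y} : Set X) := by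
      funext z
      simp [ind, Finset.sum_apply, Set.indicator_apply, Finset.sum_ite_eq]
    have h0 : ind Sᶜ x = 0 := by simp [ind, hx]
    rw [h0, e]
    refine (uto_sum T hT _ _ x).trans (Finset.sum_nonpos fun y hy => ?_)
    simp only [Finset.mem_filter, Finset.mem_univ, true_and] at hy
    by_contra hc
    exact hcl.2 x hx y hy (Relation.ReflTransGen.single (not_le.mp hc))
  · have h0 : ind Sᶜ x = 1 := by simp [ind, hx]
    rw [h0]
    refine (hT.1 _ x).trans (ciSup_le fun y => ?_)
    by_cases hy : y ∈ S <;> simp [ind, hy]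

/-- for a closed class `S` of 𝒢(T̄) that is absorbing,
`[T̄^k 𝟙_{Sᶜ}](x) → 0` for every `x`. -/
theorem tendsto_indicator_compl_zero {X : Type*} [Fintype X] [Nonempty X]
    (T : (X → ℝ) → (X → ℝ)) (hT : IsUTO T) (S : Set X)
    (hcl : ClosedIn T S) (habs : Absorbing T S) :
    ∀ x : X, Tendsto (fun k : ℕ => T^[k] (ind Sᶜ) x) atTop (𝓝 0) := by
  classical
  have hm := uto_mono T hT
  have hle := uto_ind_le T hT S hcl
  have hf0 : (0 : X → ℝ) ≤ ind Sᶜ := fun y => by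
    by_cases hy : y ∈ S <;> simp [ind, hy]
  have hnn : ∀ k, (0 : X → ℝ) ≤ T^[k] (ind Sᶜ) := by
    intro k
    induction k with
    | zero => exact hf0
    | succ k ih =>
      rw [Function.iterate_succ_apply']
      have := hm ih
      rwa [uto_zero T hT] at this
  have hanti : Antitone (fun k => T^[k] (ind Sᶜ)) := by
    refine antitone_nat_of_succ_le fun k => ?_
    rw [Function.iterate_succ_apply]
    exact hm.iterate k hle
  choose! κ hκ using habs
  obtain ⟨K, hK⟩ : ∃ K, ∀ x, κ x ≤ K :=
    ⟨Finset.univ.sup κ, fun x => Finset.le_sup (Finset.mem_univ x)⟩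
  have hlt : ∀ x, T^[K] (ind Sᶜ) x < 1 := by
    intro x
    by_cases hx : x ∈ S
    · have h1 : T^[K] (ind Sᶜ) x ≤ ind Sᶜ x := hanti (Nat.zero_le K) x
      have h0 : ind Sᶜ x = 0 := by simp [ind, hx]
      linarith
    · exact lt_of_le_of_lt (hanti (hK x) x) (hκ x hx)
  obtain ⟨z, hz⟩ := Finite.exists_max (T^[K] (ind Sᶜ))
  set c := T^[K] (ind Sᶜ) z with hc
  have hc1 : c < 1 := hlt z
  have hc0 : 0 ≤ c := hnn K z
  have hbase : T^[K] (ind Sᶜ) ≤ c • ind Sᶜ := by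
    intro x
    by_cases hx : x ∈ S
    · have h1 : T^[K] (ind Sᶜ) x ≤ ind Sᶜ x := hanti (Nat.zero_le K) x
      have h0 : ind Sᶜ x = 0 := by simp [ind, hx]
      simp only [Pi.smul_apply, smul_eq_mul]
      rw [h0] at h1 ⊢
      linarith
    · have h0 : ind Sᶜ x = 1 := by simp [ind, hx]
      simp only [Pi.smul_apply, smul_eq_mul]
      rw [h0, mul_one]
      exact hz x
  have hstep : ∀ n, T^[n + K] (ind Sᶜ) ≤ c • T^[n] (ind Sᶜ) := by
    intro n
    induction n with
    | zero => simpa using hbase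
    | succ n ih =>
      rw [Nat.succ_add, Function.iterate_succ_apply', Function.iterate_succ_apply',
        ← hT.2.2 c hc0]
      exact hm ih
  intro x
  have hax : Antitone (fun k => T^[k] (ind Sᶜ) x) := fun a b hab => hanti hab x
  have hlim := tendsto_atTop_ciInf hax ⟨0, by rintro _ ⟨k, rfl⟩; exact hnn k x⟩
  set L := ⨅ k, T^[k] (ind Sᶜ) x
  have hL0 : 0 ≤ L := ge_of_tendsto' hlim fun k => hnn k x
  have hL1 : L ≤ c * L :=
    le_of_tendsto_of_tendsto' ((tendsto_add_atTop_iff_nat K).2 hlim)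
      (hlim.const_mul c) fun n => hstep n x
  have : L = 0 := by nlinarith
  rwa [this] at hlim

end WeakErg
end
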